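/- Let φ satisfy assumptions (A1)–(A2) with α ∈ (0,2). Fix δ > 0, 0 < γ < δ/2, λ > 0, and let ω be the modulus of continuity ω(ξ) := δλ^{−1}ξ − (δ/4)λ^{−1−α/2}ξ^{1+α/2} for 0 < ξ ≤ λ and ω(ξ) := (3/4)δ + γ log(ξ/λ) for ξ > λ. Let ρ : ℝ → ℝ be smooth and 1-periodic with |ρ(a)−ρ(b)| ≤ ω(|a−b|) for all a,b, and let x ≠ y satisfy ρ(x) − ρ(y) = ω(ξ) with ξ := |x−y| ∈ (0, a₀/2]. Then the dissipation D₁(x,y) := p.v. ∫_{|z|≤a₀} φ(z)( ω(ξ) − ρ(x+z) + ρ(y+z) ) dz satisfies: D₁(x,y) ≥ (α/(32c₁)) δ λ^{−1−α/2} ξ^{1−α/2} if 0 < ξ ≤ λ, and D₁(x,y) ≥ ((2^α − 1)/(2αc₁)) ω(ξ) ξ^{−α} if λ < ξ ≤ a₀/2. -/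

import Mathlib

open Real MeasureTheory Filter Set Topology

noncomputable section

/-- Principal-value Lévy operator: (𝓛 f)(x) = p.v. ∫ φ(x-y)(f(x)-f(y)) dy. -/
def levy (φ f : ℝ → ℝ) (x : ℝ) : ℝ :=
  limUnder (nhdsWithin (0:ℝ) (Set.Ioi 0))
    (fun ε => ∫ y in {y : ℝ | ε ≤ |x - y|}, φ (x - y) * (f x - f y))

/-- Principal-value alignment force. -/
def alignForce (φ ρ u : ℝ → ℝ) (x : ℝ) : ℝ :=
  limUnder (nhdsWithin (0:ℝ) (Set.Ioi 0))
    (fun ε => ∫ y in {y : ℝ | ε ≤ |x - y|}, φ (x - y) * (u y - u x) * ρ y)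

/-- Periodization -/
def phiS (φ : ℝ → ℝ) (x : ℝ) : ℝ := ∑' k : ℤ, φ (x + (k : ℝ))

def supNorm (f : ℝ → ℝ) : ℝ := ⨆ x : ℝ, |f x|

structure A12 (φ : ℝ → ℝ) (α a₀ c₁ c₂ : ℝ) : Prop where
  αpos : 0 < α
  αlt : α < 2
  a₀pos : 0 < a₀
  a₀le : a₀ ≤ 1/2
  c₁ge : 1 ≤ c₁
  c₂pos : 0 < c₂
  even : ∀ x : ℝ, φ (-x) = φ x
  smooth : ContDiffOn ℝ 4 φ {(0:ℝ)}ᶜ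
  lower : ∀ x : ℝ, x ≠ 0 → |x| ≤ a₀ → c₁⁻¹ * |x| ^ (-(1+α)) ≤ φ x
  upper : ∀ x : ℝ, x ≠ 0 → |x| ≤ a₀ → φ x ≤ c₁ * |x| ^ (-(1+α))
  derivBound : ∀ j : ℕ, 1 ≤ j → j ≤ 4 → ∀ x : ℝ, x ≠ 0 → |x| ≤ a₀ →
    |iteratedDeriv j φ x| ≤ c₁ * |x| ^ (-(1+(j:ℝ)+α))
  mono : ∀ r s : ℝ, 0 < r → r ≤ s → s ≤ a₀ → φ s ≤ φ r
  tailInt : ∀ j : ℕ, j ≤ 4 →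
    IntegrableOn (fun x : ℝ => |x| ^ (j:ℝ) * |iteratedDeriv j φ x|) {x : ℝ | a₀ ≤ |x|}
  tailBound : ∀ j : ℕ, j ≤ 4 →
    (∫ x in {x : ℝ | a₀ ≤ |x|}, |x| ^ (j:ℝ) * |iteratedDeriv j φ x|) ≤ c₂

structure EASol (φ : ℝ → ℝ) (T : ℝ) (ρ u : ℝ → ℝ → ℝ) : Prop where
  smooth_rho : ContDiffOn ℝ (⊤ : ℕ∞) (Function.uncurry ρ) (Set.univ ×ˢ Set.Icc 0 T)
  smooth_u : ContDiffOn ℝ (⊤ : ℕ∞) (Function.uncurry u) (Set.univ ×ˢ Set.Icc 0 T)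
  periodic_rho : ∀ x t, ρ (x + 1) t = ρ x t
  periodic_u : ∀ x t, u (x + 1) t = u x t
  mass : ∀ x : ℝ, ∀ t ∈ Set.Icc 0 T,
    derivWithin (fun s => ρ x s) (Set.Icc 0 T) t + deriv (fun y => ρ y t * u y t) x = 0
  mom : ∀ x : ℝ, ∀ t ∈ Set.Icc 0 T,
    derivWithin (fun s => u x s) (Set.Icc 0 T) t + u x t * deriv (fun y => u y t) x
      = alignForce φ (fun y => ρ y t) (fun y => u y t) x

/-- The rescaled modulus of continuity `ω` with parameters `δ, γ, λ`. -/
def moc (α δ γ lam : ℝ) (ξ : ℝ) : ℝ :=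
  if ξ ≤ lam then δ * lam⁻¹ * ξ - δ / 4 * lam ^ (-(1:ℝ) - α/2) * ξ ^ (1 + α/2)
  else 3 * δ / 4 + γ * Real.log (ξ / lam)

/-- Second-order Taylor lower bound for `(1 - t) ^ p`. -/
lemma one_sub_rpow_ge_taylor_two {p t : ℝ} (hp1 : 1 ≤ p) (hp2 : p ≤ 2) (ht0 : 0 ≤ t)
    (ht1 : t ≤ 1) : 1 - p * t + p * (p - 1) / 2 * t ^ 2 ≤ (1 - t) ^ p := by
  have hder : ∀ s : ℝ, HasDerivAt
      (fun s : ℝ => (1 - s) ^ p - (1 - p * s + p * (p - 1) / 2 * s ^ 2))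
      (p * (1 - (p - 1) * s - (1 - s) ^ (p - 1))) s := by
    intro s
    have h1 : HasDerivAt (fun s : ℝ => (1 - s) ^ p) (-1 * p * (1 - s) ^ (p - 1)) s :=
      ((hasDerivAt_id s).const_sub 1).rpow_const (Or.inr hp1)
    have h2 : HasDerivAt (fun s : ℝ => 1 - p * s + p * (p - 1) / 2 * s ^ 2)
        (-(p * 1) + p * (p - 1) / 2 * (((2 : ℕ) : ℝ) * s ^ (2 - 1) * 1)) s :=
      (((hasDerivAt_id s).const_mul p).const_sub 1).add
        (((hasDerivAt_id s).pow 2).const_mul (p * (p - 1) / 2))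
    refine (h1.sub h2).congr_deriv ?_
    push_cast
    ring
  have hmono : MonotoneOn
      (fun s : ℝ => (1 - s) ^ p - (1 - p * s + p * (p - 1) / 2 * s ^ 2)) (Icc 0 1) := by
    refine monotoneOn_of_deriv_nonneg (convex_Icc 0 1)
      (fun s _ => (hder s).continuousAt.continuousWithinAt)
      (fun s _ => (hder s).differentiableAt.differentiableWithinAt) fun s hs => ?_
    rw [interior_Icc] at hs
    rw [(hder s).deriv]
    have hb := rpow_one_add_le_one_add_mul_self (s := -s) (p := p - 1)
      (by linarith [hs.2]) (by linarith) (by linarith)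
    have hb' : (1 - s) ^ (p - 1) ≤ 1 - (p - 1) * s := by
      rw [sub_eq_add_neg 1 s]; linarith
    exact mul_nonneg (by linarith) (by linarith)
  have := hmono (left_mem_Icc.2 zero_le_one) ⟨ht0, ht1⟩ ht0
  simp at this
  linarith

/-- Second-order Taylor lower bound for `(ξ - h) ^ p` around `ξ`. -/
lemma sub_rpow_ge_taylor_two {p ξ h : ℝ} (hp1 : 1 ≤ p) (hp2 : p ≤ 2) (hξ : 0 < ξ) (hh : 0 ≤ h)
    (hhξ : h ≤ ξ) :
    ξ ^ p - p * ξ ^ (p - 1) * h + p * (p - 1) / 2 * ξ ^ (p - 2) * h ^ 2 ≤ (ξ - h) ^ p := by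
  have ht1 : h / ξ ≤ 1 := (div_le_one hξ).2 hhξ
  have key := one_sub_rpow_ge_taylor_two hp1 hp2 (div_nonneg hh hξ.le) ht1
  have e : (ξ - h) ^ p = ξ ^ p * (1 - h / ξ) ^ p := by
    rw [← Real.mul_rpow hξ.le (by linarith)]
    congr 1
    field_simp
  have e2 : ξ ^ (p - 2) = ξ ^ p / ξ ^ 2 := by
    rw [Real.rpow_sub hξ, Real.rpow_two]
  rw [e, Real.rpow_sub_one hξ.ne', e2]
  refine le_trans (le_of_eq ?_) (mul_le_mul_of_nonneg_left key (Real.rpow_nonneg hξ.le p))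
  field_simp

/-- The graph of `s ↦ s ^ p` lies above its tangent lines. -/
lemma rpow_ge_tangent {p ξ s : ℝ} (hp : 1 ≤ p) (hξ : 0 < ξ) (hs : 0 ≤ s) :
    ξ ^ p + p * ξ ^ (p - 1) * (s - ξ) ≤ s ^ p := by
  have hd : 0 ≤ s / ξ := div_nonneg hs hξ.le
  have key := one_add_mul_self_le_rpow_one_add (s := s / ξ - 1) (by linarith) hp
  have e : s ^ p = ξ ^ p * (1 + (s / ξ - 1)) ^ p := by
    rw [← Real.mul_rpow hξ.le (by linarith)]
    congr 1
    field_simp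
    ring
  rw [e, Real.rpow_sub_one hξ.ne']
  refine le_trans (le_of_eq ?_) (mul_le_mul_of_nonneg_left key (Real.rpow_nonneg hξ.le p))
  field_simp

section Modulus

variable {α δ γ lam : ℝ}

lemma moc_of_le {s : ℝ} (hs : s ≤ lam) :
    moc α δ γ lam s = δ * lam⁻¹ * s - δ / 4 * lam ^ (-(1:ℝ) - α/2) * s ^ (1 + α/2) :=
  if_pos hs

lemma moc_of_ge (hlam : 0 < lam) {s : ℝ} (hs : lam ≤ s) :
    moc α δ γ lam s = 3 * δ / 4 + γ * Real.log (s / lam) := by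
  rcases hs.eq_or_lt with rfl | hs
  · rw [moc_of_le le_rfl, div_self hlam.ne', Real.log_one, mul_assoc (δ / 4),
      ← Real.rpow_add hlam]
    have : -(1:ℝ) - α / 2 + (1 + α / 2) = 0 := by ring
    rw [this, Real.rpow_zero]
    field_simp
    ring
  · exact if_neg (not_le.2 hs)

lemma moc_zero (hα : 0 < α) (hlam : 0 < lam) : moc α δ γ lam 0 = 0 := by
  rw [moc_of_le hlam.le, Real.zero_rpow (by linarith)]
  ring

/-- Below `lam`, the modulus lies under the tangent lines of its power branch. -/
lemma moc_le_tangent_of_le_of_le (hα : 0 < α) (hδ : 0 < δ) (hlam : 0 < lam) {ξ s : ℝ}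
    (hξ : 0 < ξ) (hξl : ξ ≤ lam) (hs : 0 ≤ s) (hsl : s ≤ lam) :
    moc α δ γ lam s ≤ moc α δ γ lam ξ +
      (δ * lam⁻¹ - δ / 4 * lam ^ (-(1:ℝ) - α/2) * ((1 + α/2) * ξ ^ (α/2))) * (s - ξ) := by
  rw [moc_of_le hsl, moc_of_le hξl]
  have h1 := rpow_ge_tangent (p := 1 + α / 2) (by linarith) hξ hs
  rw [add_sub_cancel_left] at h1
  have hc : 0 ≤ δ / 4 * lam ^ (-(1:ℝ) - α/2) := by positivity
  nlinarith [mul_le_mul_of_nonneg_left h1 hc]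

/-- The left slope of the modulus at `lam` dominates its right slope. -/
lemma gamma_div_le_slope (hα2 : α < 2) (hγ : γ < δ / 2) (hδ : 0 < δ) (hlam : 0 < lam) :
    γ / lam ≤ δ * lam⁻¹ - δ / 4 * lam ^ (-(1:ℝ) - α/2) * ((1 + α/2) * lam ^ (α/2)) := by
  have e : lam ^ (-(1:ℝ) - α/2) * lam ^ (α/2) = lam⁻¹ := by
    rw [← Real.rpow_add hlam, sub_add_cancel, Real.rpow_neg_one]
  have e' : δ * lam⁻¹ - δ / 4 * lam ^ (-(1:ℝ) - α/2) * ((1 + α/2) * lam ^ (α/2))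
      = (δ - δ / 4 * (1 + α / 2)) * lam⁻¹ := by
    rw [← e]; ring
  rw [e', div_eq_mul_inv]
  exact mul_le_mul_of_nonneg_right (by nlinarith) (inv_nonneg.2 hlam.le)

/-- The modulus lies below its tangent lines at points of the power branch. -/
lemma moc_le_tangent_of_le (hα : 0 < α) (hα2 : α < 2) (hδ : 0 < δ) (hγ0 : 0 < γ)
    (hγ : γ < δ / 2) (hlam : 0 < lam) {ξ s : ℝ} (hξ : 0 < ξ) (hξl : ξ ≤ lam) (hs : 0 ≤ s) :
    moc α δ γ lam s ≤ moc α δ γ lam ξ +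
      (δ * lam⁻¹ - δ / 4 * lam ^ (-(1:ℝ) - α/2) * ((1 + α/2) * ξ ^ (α/2))) * (s - ξ) := by
  rcases le_total s lam with hsl | hsl
  · exact moc_le_tangent_of_le_of_le hα hδ hlam hξ hξl hs hsl
  have h1 : moc α δ γ lam s ≤ moc α δ γ lam lam + γ / lam * (s - lam) := by
    rw [moc_of_ge hlam hsl, moc_of_ge hlam le_rfl, div_self hlam.ne', Real.log_one]
    have h2 := Real.log_le_sub_one_of_pos (div_pos (hlam.trans_le hsl) hlam)
    have h3 := mul_le_mul_of_nonneg_left h2 hγ0.le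
    have h4 : γ / lam * (s - lam) = γ * (s / lam - 1) := by field_simp
    linarith
  have h2 := moc_le_tangent_of_le_of_le (γ := γ) hα hδ hlam hξ hξl hlam.le le_rfl
  have h3 := gamma_div_le_slope (α := α) hα2 hγ hδ hlam
  have h4 : ξ ^ (α/2) ≤ lam ^ (α/2) := Real.rpow_le_rpow hξ.le hξl (by linarith)
  have hc : 0 ≤ δ / 4 * lam ^ (-(1:ℝ) - α/2) * (1 + α/2) := by positivity
  have h5 := mul_le_mul_of_nonneg_left h4 hc
  have h6 : γ / lam ≤
      δ * lam⁻¹ - δ / 4 * lam ^ (-(1:ℝ) - α/2) * ((1 + α/2) * ξ ^ (α/2)) := by linarith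
  have h7 := mul_le_mul_of_nonneg_right h6 (sub_nonneg.2 hsl)
  linarith

/-- The modulus lies below its tangent lines at points of the logarithmic branch. -/
lemma moc_le_tangent_of_ge (hα : 0 < α) (hα2 : α < 2) (hδ : 0 < δ) (hγ0 : 0 < γ)
    (hγ : γ < δ / 2) (hlam : 0 < lam) {c s : ℝ} (hc : lam ≤ c) (hs : 0 ≤ s) :
    moc α δ γ lam s ≤ moc α δ γ lam c + γ / c * (s - c) := by
  have hc0 : 0 < c := hlam.trans_le hc
  have hlog : ∀ t, lam ≤ t → moc α δ γ lam t ≤ moc α δ γ lam c + γ / c * (t - c) := by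
    intro t ht
    have ht0 := hlam.trans_le ht
    rw [moc_of_ge hlam ht, moc_of_ge hlam hc, Real.log_div ht0.ne' hlam.ne',
      Real.log_div hc0.ne' hlam.ne']
    have h2 := Real.log_le_sub_one_of_pos (div_pos ht0 hc0)
    rw [Real.log_div ht0.ne' hc0.ne'] at h2
    have h3 := mul_le_mul_of_nonneg_left h2 hγ0.le
    have h4 : γ / c * (t - c) = γ * (t / c - 1) := by field_simp
    linarith
  rcases le_total lam s with hsl | hsl
  · exact hlog s hsl
  have h1 := moc_le_tangent_of_le_of_le (γ := γ) hα hδ hlam hlam le_rfl hs hsl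
  have h2 := gamma_div_le_slope (α := α) hα2 hγ hδ hlam
  have h3 := hlog lam le_rfl
  have h4 : γ / c ≤ γ / lam := div_le_div_of_nonneg_left hγ0.le hlam hc
  have h5 := mul_le_mul_of_nonneg_right (h4.trans h2) (sub_nonneg.2 hsl)
  linarith

/-- Quantitative concavity of the modulus on its power branch. -/
lemma moc_second_difference (hα : 0 < α) (hα2 : α < 2) (hδ : 0 < δ) (hγ0 : 0 < γ)
    (hγ : γ < δ / 2) (hlam : 0 < lam) {ξ η : ℝ} (hξ : 0 < ξ) (hξl : ξ ≤ lam) (hη : 0 ≤ η)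
    (hηξ : 2 * η ≤ ξ) :
    δ / 4 * lam ^ (-(1:ℝ) - α/2) * ((1 + α/2) * α) * ξ ^ (α/2 - 1) * η ^ 2 ≤
      2 * moc α δ γ lam ξ - moc α δ γ lam (ξ + 2 * η) - moc α δ γ lam (ξ - 2 * η) := by
  have h1 := moc_le_tangent_of_le hα hα2 hδ hγ0 hγ hlam hξ hξl
    (by linarith : 0 ≤ ξ + 2 * η)
  have h2 := sub_rpow_ge_taylor_two (p := 1 + α / 2) (by linarith) (by linarith) hξ
    (by linarith : 0 ≤ 2 * η) hηξ
  have e : 1 + α / 2 - 2 = α / 2 - 1 := by ring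
  rw [add_sub_cancel_left, e] at h2
  have hc : 0 ≤ δ / 4 * lam ^ (-(1:ℝ) - α/2) := by positivity
  have h3 := mul_le_mul_of_nonneg_left h2 hc
  rw [moc_of_le (s := ξ - 2 * η) (by linarith)]
  rw [moc_of_le hξl] at h1 ⊢
  linarith

/-- Growth of the modulus on its logarithmic branch. -/
lemma moc_growth (hγ0 : 0 < γ) (hγ : γ < δ / 2) (hlam : 0 < lam) {ξ r : ℝ} (hξ : lam ≤ ξ)
    (hr : ξ ≤ 2 * r) :
    ξ * moc α δ γ lam (2 * r) ≤
      2 * r * moc α δ γ lam ξ - moc α δ γ lam ξ / 2 * (r - ξ / 2) := by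
  have hξ0 := hlam.trans_le hξ
  have hr0 : 0 < 2 * r := by linarith
  have h1 : moc α δ γ lam (2 * r) = moc α δ γ lam ξ + γ * Real.log (2 * r / ξ) := by
    rw [moc_of_ge hlam hξ, moc_of_ge hlam (hξ.trans hr), Real.log_div hr0.ne' hlam.ne',
      Real.log_div hξ0.ne' hlam.ne', Real.log_div hr0.ne' hξ0.ne']
    ring
  have h2 : ξ * Real.log (2 * r / ξ) ≤ 2 * r - ξ := by
    have := mul_le_mul_of_nonneg_left
      (Real.log_le_sub_one_of_pos (div_pos hr0 hξ0)) hξ0.le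
    refine this.trans (le_of_eq ?_)
    field_simp
  have h3 : 3 * δ / 4 ≤ moc α δ γ lam ξ := by
    rw [moc_of_ge hlam hξ]
    have := Real.log_nonneg ((one_le_div hlam).2 hξ)
    nlinarith
  rw [h1]
  have h4 := mul_le_mul_of_nonneg_left h2 hγ0.le
  have h5 : γ * (2 * r - ξ) ≤ moc α δ γ lam ξ * (3 / 4) * (2 * r - ξ) :=
    mul_le_mul_of_nonneg_right (by linarith) (by linarith)
  linarith

end Modulus

/-- If `φ` is nonnegative and antitone and `U ≥ 0`, then `∫ φ U' ≥ -φ(b) U(b)`. -/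
lemma neg_mul_le_integral_mul_deriv_of_antitoneOn {φ U u : ℝ → ℝ} {a b : ℝ} (hba : b < a)
    (hφd : ∀ t ∈ Icc b a, DifferentiableAt ℝ φ t) (hφc : ContinuousOn (deriv φ) (Icc b a))
    (hφ : AntitoneOn φ (Icc b a)) (hφa : 0 ≤ φ a) (hU : ∀ t, HasDerivAt U (u t) t)
    (hu : Continuous u) (hU0 : ∀ t ∈ Icc b a, 0 ≤ U t) :
    -(φ b * U b) ≤ ∫ t in b..a, φ t * u t := by
  have hI : uIcc b a = Icc b a := uIcc_of_le hba.le
  rw [intervalIntegral.integral_mul_deriv_eq_deriv_mul (u := φ) (u' := deriv φ) (v := U)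
    (fun t ht => (hφd t (hI ▸ ht)).hasDerivAt) (fun t _ => hU t)
    (by rw [← hI] at hφc; exact hφc.intervalIntegrable) (hu.intervalIntegrable _ _)]
  have h1 : 0 ≤ ∫ t in b..a, -(deriv φ t * U t) := by
    refine intervalIntegral.integral_nonneg hba.le fun t ht => ?_
    have h2 : deriv φ t ≤ 0 := by
      rw [← (hφd t ht).derivWithin (uniqueDiffOn_Icc hba t ht)]
      exact hφ.derivWithin_nonpos
    nlinarith [mul_nonneg (neg_nonneg.2 h2) (hU0 t ht)]
  rw [intervalIntegral.integral_neg] at h1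
  have h2 := mul_nonneg hφa (hU0 a (right_mem_Icc.2 hba.le))
  linarith

/-- The defect `2 w - (ρ (x ± η) - ρ (y ± η))` summed over both signs. -/
def symmDefect (ρ : ℝ → ℝ) (x y w η : ℝ) : ℝ :=
  2 * w - ρ (x + η) + ρ (y + η) - ρ (x - η) + ρ (y - η)

lemma contDiff_symmDefect {ρ : ℝ → ℝ} {n : WithTop ℕ∞} (hρ : ContDiff ℝ n ρ) (x y w : ℝ) :
    ContDiff ℝ n (symmDefect ρ x y w) := by
  unfold symmDefect
  fun_prop

lemma continuous_symmDefect {ρ : ℝ → ℝ} (hρ : Continuous ρ) (x y w : ℝ) :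
    Continuous (symmDefect ρ x y w) := by
  unfold symmDefect
  fun_prop

lemma symmDefect_zero {ρ : ℝ → ℝ} {x y w : ℝ} (hscen : ρ x - ρ y = w) :
    symmDefect ρ x y w 0 = 0 := by
  simp only [symmDefect, add_zero, sub_zero]
  linarith

lemma symmDefect_nonneg {ρ : ℝ → ℝ} {x y w : ℝ} (hw : ∀ z, ρ (x + z) - ρ (y + z) ≤ w) (t : ℝ) :
    0 ≤ symmDefect ρ x y w t := by
  have h1 := hw t
  have h2 := hw (-t)
  simp only [← sub_eq_add_neg] at h2
  simp only [symmDefect]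
  linarith

lemma symmDefect_comp_neg (ρ : ℝ → ℝ) (x y w η : ℝ) :
    symmDefect (fun s => ρ (-s)) (-x) (-y) w η = symmDefect ρ x y w η := by
  have e : ∀ a : ℝ, -(-a + η) = a - η ∧ -(-a - η) = a + η :=
    fun a => ⟨by ring, by ring⟩
  simp only [symmDefect, (e x).1, (e x).2, (e y).1, (e y).2]
  ring

/-- A nonnegative `C²` function vanishing at the origin is `O(t ^ 2)` to the right of it. -/
lemma exists_le_mul_sq_of_nonneg {f : ℝ → ℝ} (hf : ContDiff ℝ 2 f) (hf0 : f 0 = 0)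
    (hfn : ∀ t, 0 ≤ f t) {a : ℝ} (ha : 0 < a) : ∃ C, ∀ t ∈ Icc 0 a, f t ≤ C * t ^ 2 := by
  obtain ⟨C, hC⟩ := exists_taylor_mean_remainder_bound (f := f) (n := 1) ha.le
    (by norm_num; exact hf.contDiffOn)
  refine ⟨C, fun t ht => ?_⟩
  have hd : deriv f 0 = 0 :=
    IsLocalMin.deriv_eq_zero (Eventually.of_forall fun t => by rw [hf0]; exact hfn t)
  have hdw : derivWithin f (Icc 0 a) 0 = 0 := by
    rw [(hf.differentiable (by norm_num) 0).derivWithin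
      (uniqueDiffOn_Icc ha 0 (left_mem_Icc.2 ha.le)), hd]
  have h1 := hC t ht
  simp only [taylorWithinEval_succ, taylor_within_zero_eval, hf0, CharP.cast_eq_zero, zero_add,
    iteratedDerivWithin_one, hdw, smul_zero, sub_zero, Nat.factorial] at h1
  exact (le_abs_self _).trans h1

section Kernel

variable {φ : ℝ → ℝ} {α a₀ c₁ c₂ : ℝ}

lemma A12.continuousOn (h : A12 φ α a₀ c₁ c₂) : ContinuousOn φ {(0:ℝ)}ᶜ := h.smooth.continuousOn

lemma A12.nonneg (h : A12 φ α a₀ c₁ c₂) {t : ℝ} (ht : 0 < t) (hta : t ≤ a₀) : 0 ≤ φ t := by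
  have h1 := h.lower t ht.ne' (by rwa [abs_of_pos ht])
  have := h.c₁ge
  exact le_trans (by positivity) h1

lemma A12.intervalIntegrable_mul (h : A12 φ α a₀ c₁ c₂) {f : ℝ → ℝ} (hf : ContDiff ℝ 2 f)
    (hf0 : f 0 = 0) (hfn : ∀ t, 0 ≤ f t) :
    IntervalIntegrable (fun t => φ t * f t) volume 0 a₀ := by
  obtain ⟨C, hC⟩ := exists_le_mul_sq_of_nonneg hf hf0 hfn h.a₀pos
  have hg : IntervalIntegrable (fun t : ℝ => c₁ * C * t ^ (1 - α)) volume 0 a₀ :=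
    (intervalIntegral.intervalIntegrable_rpow' (by linarith [h.αlt])).const_mul _
  have hsub : uIoc 0 a₀ ⊆ {(0:ℝ)}ᶜ := by
    rw [uIoc_of_le h.a₀pos.le]
    exact fun t ht => ht.1.ne'
  refine hg.mono_fun' (((h.continuousOn.mono hsub).mul
    hf.continuous.continuousOn).aestronglyMeasurable measurableSet_uIoc) ?_
  refine (ae_restrict_iff' measurableSet_uIoc).2 (Eventually.of_forall fun t ht => ?_)
  rw [uIoc_of_le h.a₀pos.le] at ht
  have h1 := h.upper t ht.1.ne' (by rw [abs_of_pos ht.1]; exact ht.2)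
  rw [abs_of_pos ht.1] at h1
  have hφ := h.nonneg ht.1 ht.2
  have hpow : t ^ (1 - α) = t ^ (-(1 + α)) * t ^ 2 := by
    rw [← Real.rpow_natCast, ← Real.rpow_add ht.1]
    congr 1
    push_cast
    ring
  change ‖φ t * f t‖ ≤ c₁ * C * t ^ (1 - α)
  rw [Real.norm_of_nonneg (mul_nonneg hφ (hfn t)), hpow]
  calc φ t * f t ≤ (c₁ * t ^ (-(1 + α))) * (C * t ^ 2) :=
        mul_le_mul h1 (hC t ⟨ht.1.le, ht.2⟩) (hfn t) (hφ.trans h1)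
    _ = _ := by ring

/-- For an even kernel the truncated integral folds to an integral over positive `η`. -/
lemma A12.setIntegral_annulus (h : A12 φ α a₀ c₁ c₂) {ρ : ℝ → ℝ} (hρ : Continuous ρ)
    (x y w : ℝ) {ε : ℝ} (hε : 0 < ε) (hεa : ε ≤ a₀) :
    ∫ z in {z : ℝ | ε ≤ |z| ∧ |z| ≤ a₀}, φ z * (w - ρ (x + z) + ρ (y + z)) =
      ∫ η in ε..a₀, φ η * symmDefect ρ x y w η := by
  set f : ℝ → ℝ := fun z => φ z * (w - ρ (x + z) + ρ (y + z)) with hf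
  have hset : {z : ℝ | ε ≤ |z| ∧ |z| ≤ a₀} = Icc (-a₀) (-ε) ∪ Icc ε a₀ := by
    ext z
    simp only [mem_ofPred_eq, mem_union, mem_Icc, le_abs, abs_le]
    constructor
    · rintro ⟨h1 | h1, h2, h3⟩
      · exact Or.inr ⟨h1, h3⟩
      · exact Or.inl ⟨h2, by linarith⟩
    · rintro (⟨h1, h2⟩ | ⟨h1, h2⟩)
      · exact ⟨Or.inr (by linarith), h1, by linarith⟩
      · exact ⟨Or.inl h1, by linarith, h2⟩
  have hcont : ContinuousOn f {(0:ℝ)}ᶜ := h.continuousOn.mul (by fun_prop)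
  have hs1 : Icc (-a₀) (-ε) ⊆ {(0:ℝ)}ᶜ := fun t ht => (by linarith [ht.2] : t < 0).ne
  have hs2 : Icc ε a₀ ⊆ {(0:ℝ)}ᶜ := fun t ht => (by linarith [ht.1] : 0 < t).ne'
  have hi1 := (hcont.mono hs1).integrableOn_Icc (μ := volume)
  have hi2 := (hcont.mono hs2).integrableOn_Icc (μ := volume)
  have hdisj : Disjoint (Icc (-a₀) (-ε)) (Icc ε a₀) :=
    Set.disjoint_left.2 fun t h1 h2 => by linarith [h1.2, h2.1]
  have hneg : ∫ z in (-a₀)..(-ε), f z = ∫ z in ε..a₀, f (-z) := by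
    rw [intervalIntegral.integral_comp_neg]
  have hi3 : IntervalIntegrable (fun z => f (-z)) volume ε a₀ := by
    refine ContinuousOn.intervalIntegrable ?_
    rw [uIcc_of_le hεa]
    exact hcont.comp continuous_neg.continuousOn fun t ht => neg_ne_zero.2 (hs2 ht)
  rw [hset, setIntegral_union hdisj measurableSet_Icc hi1 hi2, integral_Icc_eq_integral_Ioc,
    integral_Icc_eq_integral_Ioc, ← intervalIntegral.integral_of_le (by linarith),
    ← intervalIntegral.integral_of_le hεa, hneg, ← intervalIntegral.integral_add hi3
      ((intervalIntegrable_iff_integrableOn_Icc_of_le hεa).2 hi2)]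
  refine intervalIntegral.integral_congr fun t _ => ?_
  simp only [hf, symmDefect, h.even, ← sub_eq_add_neg]
  ring

/-- The principal value equals the folded, absolutely convergent integral. -/
lemma A12.limUnder_eq_integral (h : A12 φ α a₀ c₁ c₂) {ρ : ℝ → ℝ} (hρ : ContDiff ℝ 2 ρ)
    {x y w : ℝ} (hscen : ρ x - ρ y = w) (hw : ∀ z, ρ (x + z) - ρ (y + z) ≤ w) :
    limUnder (𝓝[>] (0:ℝ)) (fun ε => ∫ z in {z : ℝ | ε ≤ |z| ∧ |z| ≤ a₀},
      φ z * (w - ρ (x + z) + ρ (y + z))) = ∫ η in (0:ℝ)..a₀, φ η * symmDefect ρ x y w η := by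
  have hint := h.intervalIntegrable_mul (contDiff_symmDefect hρ x y w)
    (symmDefect_zero hscen) (symmDefect_nonneg hw)
  have hcont := intervalIntegral.continuousOn_primitive_interval_left
    ((intervalIntegrable_iff' enorm_ne_top).1 hint)
  have ht := hcont 0 left_mem_uIcc
  rw [uIcc_of_le h.a₀pos.le] at ht
  have hsub : 𝓝[>] (0:ℝ) ≤ 𝓝[Icc 0 a₀] 0 := by
    rw [← nhdsWithin_Ioc_eq_nhdsGT h.a₀pos]
    exact nhdsWithin_mono _ Ioc_subset_Icc_self
  refine Tendsto.limUnder_eq ((ht.mono_left hsub).congr' ?_)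
  filter_upwards [Ioc_mem_nhdsGT h.a₀pos] with ε hε
  exact (h.setIntegral_annulus hρ.continuous x y w hε.1 hε.2).symm

end Kernel

section Bounds

variable {φ ρ : ℝ → ℝ} {α a₀ c₁ c₂ δ γ lam x y ξ : ℝ}

/-- Dissipation bound at distances on the power branch of the modulus. -/
lemma integral_symmDefect_ge_of_le (h : A12 φ α a₀ c₁ c₂) (hδ : 0 < δ) (hγ0 : 0 < γ)
    (hγ : γ < δ / 2) (hlam : 0 < lam) (hob : ∀ a b, ρ a - ρ b ≤ moc α δ γ lam |a - b|)
    (hxy : x - y = ξ) (hξ : 0 < ξ) (hξa : ξ ≤ a₀ / 2) (hξl : ξ ≤ lam)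
    (hint : IntervalIntegrable
      (fun η => φ η * symmDefect ρ x y (moc α δ γ lam ξ) η) volume 0 a₀)
    (hG : ∀ t, 0 ≤ symmDefect ρ x y (moc α δ γ lam ξ) t) :
    α / (32 * c₁) * δ * lam ^ (-(1:ℝ) - α/2) * ξ ^ (1 - α/2) ≤
      ∫ η in (0:ℝ)..a₀, φ η * symmDefect ρ x y (moc α δ γ lam ξ) η := by
  have hα := h.αpos
  have hα2 := h.αlt
  have ha := h.a₀pos
  have hc₁ : 0 < c₁ := zero_lt_one.trans_le h.c₁ge
  set w := moc α δ γ lam ξ with hw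
  set K : ℝ := δ / 4 * lam ^ (-(1:ℝ) - α/2) * ((1 + α/2) * α) * ξ ^ (α/2 - 1) with hK
  have hK0 : 0 ≤ K := by positivity
  have hmid : (ξ / 2) ∈ uIcc 0 a₀ := by
    rw [uIcc_of_le ha.le]
    constructor <;> linarith
  have hint1 := hint.mono_set (uIcc_subset_uIcc left_mem_uIcc hmid)
  have hint2 := hint.mono_set (uIcc_subset_uIcc hmid right_mem_uIcc)
  have htail : 0 ≤ ∫ η in (ξ / 2)..a₀, φ η * symmDefect ρ x y w η :=
    intervalIntegral.integral_nonneg (by linarith) fun t ht =>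
      mul_nonneg (h.nonneg (by linarith [ht.1]) ht.2) (hG t)
  have hpt : ∀ t ∈ Ioo 0 (ξ / 2),
      c₁⁻¹ * K * t ^ (1 - α) ≤ φ t * symmDefect ρ x y w t := by
    intro t ht
    have h1 := h.lower t ht.1.ne' (by rw [abs_of_pos ht.1]; linarith [ht.2])
    rw [abs_of_pos ht.1] at h1
    have h2 := moc_second_difference hα hα2 hδ hγ0 hγ hlam hξ hξl ht.1.le (by linarith [ht.2])
    rw [← hK, ← hw] at h2
    have h3 := hob (x + t) (y - t)
    have h4 := hob (x - t) (y + t)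
    have e3 : |x + t - (y - t)| = ξ + 2 * t := by
      rw [abs_of_pos (by linarith [ht.1])]; linarith
    have e4 : |x - t - (y + t)| = ξ - 2 * t := by
      rw [abs_of_pos (by linarith [ht.2])]; linarith
    rw [e3] at h3
    rw [e4] at h4
    have h5 : K * t ^ 2 ≤ symmDefect ρ x y w t := by
      simp only [symmDefect]
      linarith
    have hpow : t ^ (1 - α) = t ^ (-(1 + α)) * t ^ 2 := by
      rw [← Real.rpow_natCast, ← Real.rpow_add ht.1]
      congr 1
      push_cast
      ring
    calc c₁⁻¹ * K * t ^ (1 - α) = (c₁⁻¹ * t ^ (-(1 + α))) * (K * t ^ 2) := by rw [hpow]; ring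
      _ ≤ φ t * symmDefect ρ x y w t :=
        mul_le_mul h1 h5 (by positivity) (h.nonneg ht.1 (by linarith [ht.2]))
  have hhead : ∫ t in (0:ℝ)..(ξ / 2), c₁⁻¹ * K * t ^ (1 - α) ≤
      ∫ t in (0:ℝ)..(ξ / 2), φ t * symmDefect ρ x y w t :=
    intervalIntegral.integral_mono_on_of_le_Ioo (by linarith)
      ((intervalIntegral.intervalIntegrable_rpow' (by linarith)).const_mul _) hint1 hpt
  rw [intervalIntegral.integral_const_mul, integral_rpow (Or.inl (by linarith)),
    Real.zero_rpow (by linarith), sub_zero] at hhead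
  rw [← intervalIntegral.integral_add_adjacent_intervals hint1 hint2]
  refine le_trans ?_ (le_add_of_le_of_nonneg hhead htail)
  have e1 : 1 - α + 1 = 2 - α := by ring
  have e2 : ξ ^ (α/2 - 1) * ξ ^ (2 - α) = ξ ^ (1 - α/2) := by
    rw [← Real.rpow_add hξ]
    congr 1
    ring
  have e3 : (2:ℝ) ^ (2 - α) ≤ 4 := by
    have := Real.rpow_le_rpow_of_exponent_le (one_le_two : (1:ℝ) ≤ 2)
      (by linarith : 2 - α ≤ (2:ℝ))
    norm_num at this
    exact this
  rw [e1, Real.div_rpow hξ.le zero_le_two]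
  have e4 : c₁⁻¹ * K * (ξ ^ (2 - α) / 2 ^ (2 - α) / (2 - α)) =
      (δ * lam ^ (-(1:ℝ) - α/2) * ξ ^ (1 - α/2) * α * c₁⁻¹) *
        ((1 + α / 2) / (4 * (2 ^ (2 - α) * (2 - α)))) := by
    rw [hK, ← e2]
    have : (2:ℝ) ^ (2 - α) ≠ 0 := (Real.rpow_pos_of_pos two_pos _).ne'
    have : 2 - α ≠ 0 := by linarith
    field_simp
  have e5 : α / (32 * c₁) * δ * lam ^ (-(1:ℝ) - α/2) * ξ ^ (1 - α/2) =
      (δ * lam ^ (-(1:ℝ) - α/2) * ξ ^ (1 - α/2) * α * c₁⁻¹) * (1 / 32) := by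
    field_simp
  rw [e4, e5]
  refine mul_le_mul_of_nonneg_left ?_ (by positivity)
  have e6 : (0:ℝ) < 2 ^ (2 - α) := Real.rpow_pos_of_pos two_pos _
  have e7 : (0:ℝ) < 2 - α := by linarith
  rw [div_le_div_iff₀ (by norm_num) (by positivity)]
  have e8 : (2:ℝ) ^ (2 - α) * (2 - α) ≤ 4 * 2 :=
    mul_le_mul e3 (by linarith) e7.le (by norm_num)
  linarith

/-- Primitive of `symmDefect` in terms of a primitive `R` of `ρ`. -/
lemma hasDerivAt_symmDefect_primitive {R : ℝ → ℝ} (hR : ∀ t, HasDerivAt R (ρ t) t)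
    (x y w r : ℝ) :
    HasDerivAt (fun r => 2 * r * w - (R (x + r) - R (x - r) - R (y + r) + R (y - r)))
      (symmDefect ρ x y w r) r := by
  have hp : ∀ c, HasDerivAt (fun r => R (c + r)) (ρ (c + r)) r := fun c => (hR _).comp_const_add c r
  have hm : ∀ c, HasDerivAt (fun r => R (c - r)) (-ρ (c - r)) r := fun c => (hR _).comp_const_sub c r
  have h1 : HasDerivAt (fun r : ℝ => 2 * r * w) (2 * 1 * w) r :=
    ((hasDerivAt_id r).const_mul 2).mul_const w
  refine (h1.sub ((((hp x).sub (hm x)).sub (hp y)).add (hm y))).congr_deriv ?_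
  simp only [symmDefect]
  ring

/-- Averaging the modulus over a symmetric window controls the window difference of `R`. -/
lemma primitive_difference_le (hα : 0 < α) (hα2 : α < 2) (hδ : 0 < δ) (hγ0 : 0 < γ)
    (hγ : γ < δ / 2) (hlam : 0 < lam) (hob : ∀ a b, ρ a - ρ b ≤ moc α δ γ lam |a - b|)
    {R : ℝ → ℝ} (hR : ∀ t, HasDerivAt R (ρ t) t) (hxy : x - y = ξ) (hξ : lam ≤ ξ) {r : ℝ}
    (hr : ξ ≤ 2 * r) :
    R (x + r) - R (x - r) - R (y + r) + R (y - r) ≤ ξ * moc α δ γ lam (2 * r) := by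
  have hξ0 := hlam.trans_le hξ
  set m := (x + y) / 2 with hm
  set K : ℝ → ℝ := fun v => R (m + r + v) + R (m - r - v) -
    (moc α δ γ lam (2 * r) * v + γ / (2 * r) * v ^ 2) with hK
  have hder : ∀ v, HasDerivAt K (ρ (m + r + v) - ρ (m - r - v) -
      (moc α δ γ lam (2 * r) + γ / (2 * r) * (2 * v))) v := by
    intro v
    have h1 : HasDerivAt (fun v => R (m + r + v)) (ρ (m + r + v)) v :=
      (hR _).comp_const_add (m + r) v
    have h2 : HasDerivAt (fun v => R (m - r - v)) (-ρ (m - r - v)) v :=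
      (hR _).comp_const_sub (m - r) v
    have h3 : HasDerivAt (fun v : ℝ => moc α δ γ lam (2 * r) * v + γ / (2 * r) * v ^ 2)
        (moc α δ γ lam (2 * r) * 1 + γ / (2 * r) * (((2 : ℕ) : ℝ) * v ^ (2 - 1) * 1)) v :=
      ((hasDerivAt_id v).const_mul _).add (((hasDerivAt_id v).pow 2).const_mul _)
    refine ((h1.add h2).sub h3).congr_deriv ?_
    push_cast
    ring
  have hanti : AntitoneOn K (Icc (-(ξ / 2)) (ξ / 2)) := by
    refine antitoneOn_of_deriv_nonpos (convex_Icc _ _)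
      (fun v _ => (hder v).continuousAt.continuousWithinAt)
      (fun v _ => (hder v).differentiableAt.differentiableWithinAt) fun v hv => ?_
    rw [interior_Icc] at hv
    rw [(hder v).deriv]
    have h1 := hob (m + r + v) (m - r - v)
    have e1 : |m + r + v - (m - r - v)| = 2 * r + 2 * v := by
      rw [abs_of_pos (by linarith [hv.1])]; ring
    rw [e1] at h1
    have h2 := moc_le_tangent_of_ge hα hα2 hδ hγ0 hγ hlam (hξ.trans hr)
      (by linarith [hv.1] : 0 ≤ 2 * r + 2 * v)
    rw [add_sub_cancel_left] at h2
    linarith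
  have h1 := hanti (left_mem_Icc.2 (by linarith)) (right_mem_Icc.2 (by linarith))
    (by linarith : -(ξ / 2) ≤ ξ / 2)
  simp only [hK] at h1
  have e1 : m + r + ξ / 2 = x + r := by linarith
  have e2 : m - r - ξ / 2 = y - r := by linarith
  have e3 : m + r + -(ξ / 2) = y + r := by linarith
  have e4 : m - r - -(ξ / 2) = x - r := by linarith
  rw [e1, e2, e3, e4] at h1
  linarith

/-- Dissipation bound at distances on the logarithmic branch of the modulus. -/
lemma integral_symmDefect_ge_of_lt (h : A12 φ α a₀ c₁ c₂) (hρ : Continuous ρ) (hδ : 0 < δ)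
    (hγ0 : 0 < γ) (hγ : γ < δ / 2) (hlam : 0 < lam)
    (hob : ∀ a b, ρ a - ρ b ≤ moc α δ γ lam |a - b|)
    (hxy : x - y = ξ) (hξa : ξ ≤ a₀ / 2) (hξl : lam < ξ)
    (hint : IntervalIntegrable
      (fun η => φ η * symmDefect ρ x y (moc α δ γ lam ξ) η) volume 0 a₀)
    (hG : ∀ t, 0 ≤ symmDefect ρ x y (moc α δ γ lam ξ) t) :
    (2 ^ α - 1) / (2 * α * c₁) * moc α δ γ lam ξ * ξ ^ (-α) ≤
      ∫ η in (0:ℝ)..a₀, φ η * symmDefect ρ x y (moc α δ γ lam ξ) η := by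
  have hα := h.αpos
  have hα2 := h.αlt
  have ha := h.a₀pos
  have hc₁ : 0 < c₁ := zero_lt_one.trans_le h.c₁ge
  have hξ : 0 < ξ := hlam.trans hξl
  have hw0 : 0 ≤ moc α δ γ lam ξ := by
    rw [moc_of_ge hlam hξl.le]
    have := Real.log_nonneg ((one_le_div hlam).2 hξl.le)
    positivity
  have hgrow : ∀ r, ξ ≤ 2 * r → ξ * moc α δ γ lam (2 * r) ≤
      2 * r * moc α δ γ lam ξ - moc α δ γ lam ξ / 2 * (r - ξ / 2) :=
    fun r hr => moc_growth hγ0 hγ hlam hξl.le hr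
  set w := moc α δ γ lam ξ with hw
  have hGc := continuous_symmDefect hρ x y w
  obtain ⟨R, hR⟩ : ∃ R : ℝ → ℝ, ∀ t, HasDerivAt R (ρ t) t :=
    ⟨fun t => ∫ s in (0:ℝ)..t, ρ s, fun t => hρ.integral_hasStrictDerivAt 0 t |>.hasDerivAt⟩
  set A : ℝ → ℝ := fun r => 2 * r * w - (R (x + r) - R (x - r) - R (y + r) + R (y - r)) with hA
  have hAd : ∀ r, HasDerivAt A (symmDefect ρ x y w r) r := hasDerivAt_symmDefect_primitive hR x y w
  have hmid : (ξ / 2) ∈ uIcc 0 a₀ := by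
    rw [uIcc_of_le ha.le]
    constructor <;> linarith
  have hint1 := hint.mono_set (uIcc_subset_uIcc left_mem_uIcc hmid)
  have hint2 := hint.mono_set (uIcc_subset_uIcc hmid right_mem_uIcc)
  have hsub : Icc (ξ / 2) a₀ ⊆ {(0:ℝ)}ᶜ := fun t ht => (by linarith [ht.1] : 0 < t).ne'
  have hopen : IsOpen ({(0:ℝ)}ᶜ : Set ℝ) := isOpen_compl_singleton
  have hhead : φ (ξ / 2) * A (ξ / 2) ≤ ∫ t in (0:ℝ)..(ξ / 2), φ t * symmDefect ρ x y w t := by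
    have e : A (ξ / 2) = ∫ t in (0:ℝ)..(ξ / 2), symmDefect ρ x y w t := by
      rw [intervalIntegral.integral_eq_sub_of_hasDerivAt (fun t _ => hAd t)
        (hGc.intervalIntegrable _ _)]
      simp [hA]
    rw [e, ← intervalIntegral.integral_const_mul]
    refine intervalIntegral.integral_mono_on_of_le_Ioo (by linarith)
      ((hGc.intervalIntegrable _ _).const_mul _) hint1 fun t ht => ?_
    exact mul_le_mul_of_nonneg_right (h.mono t (ξ / 2) ht.1 ht.2.le (by linarith)) (hG t)
  have hU : ∀ t, HasDerivAt (fun r => A r - w / 2 * (r - ξ / 2))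
      (symmDefect ρ x y w t - w / 2) t := fun t => by
    have h1 : HasDerivAt (fun r => w / 2 * (r - ξ / 2)) (w / 2 * 1) t :=
      ((hasDerivAt_id t).sub_const _).const_mul _
    exact ((hAd t).sub h1).congr_deriv (by ring)
  have htail := neg_mul_le_integral_mul_deriv_of_antitoneOn (φ := φ) (a := a₀) (b := ξ / 2)
    (by linarith)
    (fun t ht => (h.smooth.contDiffAt (hopen.mem_nhds (hsub ht))).differentiableAt (by norm_num))
    ((h.smooth.continuousOn_deriv_of_isOpen hopen (by norm_num)).mono hsub)
    (fun s hs t ht hst => h.mono s t (by linarith [hs.1]) hst ht.2)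
    (h.nonneg ha le_rfl) hU (hGc.sub continuous_const) (fun t ht => by
      have h1 := primitive_difference_le hα hα2 hδ hγ0 hγ hlam hob hR hxy hξl.le
        (by linarith [ht.1] : ξ ≤ 2 * t)
      have h2 := hgrow t (by linarith [ht.1])
      simp only [hA]
      linarith)
  have hφi : IntervalIntegrable φ volume (ξ / 2) a₀ := by
    refine ContinuousOn.intervalIntegrable ?_
    rw [uIcc_of_le (by linarith)]
    exact h.continuousOn.mono hsub
  simp only [sub_self, mul_zero, sub_zero, mul_sub] at htail
  rw [intervalIntegral.integral_sub hint2 (hφi.mul_const _),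
    intervalIntegral.integral_mul_const] at htail
  have h0 : (0:ℝ) ∉ uIcc (ξ / 2) a₀ := by
    rw [uIcc_of_le (by linarith)]
    exact fun h0 => hsub h0 rfl
  have hφlow : c₁⁻¹ * ((a₀ ^ (-α) - (ξ / 2) ^ (-α)) / (-α)) ≤ ∫ t in (ξ / 2)..a₀, φ t := by
    have e : -(1 + α) + 1 = -α := by ring
    rw [← e, ← integral_rpow (Or.inr ⟨by linarith, h0⟩), ← intervalIntegral.integral_const_mul]
    refine intervalIntegral.integral_mono_on (by linarith)
      ((intervalIntegral.intervalIntegrable_rpow (Or.inr h0)).const_mul _) hφi fun t ht => ?_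
    have ht0 : 0 < t := by linarith [ht.1]
    have := h.lower t ht0.ne' (by rw [abs_of_pos ht0]; exact ht.2)
    rwa [abs_of_pos ht0] at this
  rw [← intervalIntegral.integral_add_adjacent_intervals hint1 hint2]
  have hfinal : (2 ^ α - 1) / (2 * α * c₁) * w * ξ ^ (-α) ≤
      (c₁⁻¹ * ((a₀ ^ (-α) - (ξ / 2) ^ (-α)) / (-α))) * (w / 2) := by
    have e1 : a₀ ^ (-α) ≤ ξ ^ (-α) :=
      Real.rpow_le_rpow_of_nonpos hξ (by linarith) (by linarith)
    have e2 : (ξ / 2) ^ (-α) = 2 ^ α * ξ ^ (-α) := by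
      rw [Real.div_rpow hξ.le zero_le_two, Real.rpow_neg zero_le_two, div_inv_eq_mul, mul_comm]
    rw [e2]
    have e3 : (2 ^ α - 1) / (2 * α * c₁) * w * ξ ^ (-α) =
        (w / (2 * α * c₁)) * (2 ^ α * ξ ^ (-α) - ξ ^ (-α)) := by ring
    have e4 : (c₁⁻¹ * ((a₀ ^ (-α) - 2 ^ α * ξ ^ (-α)) / (-α))) * (w / 2) =
        (w / (2 * α * c₁)) * (2 ^ α * ξ ^ (-α) - a₀ ^ (-α)) := by
      field_simp
      ring
    rw [e3, e4]
    exact mul_le_mul_of_nonneg_left (by linarith) (by positivity)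
  have := mul_le_mul_of_nonneg_right hφlow (by linarith : 0 ≤ w / 2)
  linarith

end Bounds

/-- (Explicit dissipation lower bound for the concrete modulus.) At a
breakthrough pair `x ≠ y` with `ρ(x) − ρ(y) = ω(ξ)`, `ξ = |x−y| ≤ a₀/2`:
`D₁ ≥ (α/(32c₁)) δ λ^{-1-α/2} ξ^{1-α/2}` for `ξ ≤ λ`, and
`D₁ ≥ ((2^α−1)/(2αc₁)) ω(ξ) ξ^{-α}` for `λ < ξ`. -/
theorem stmt15 (φ : ℝ → ℝ) (α a₀ c₁ c₂ : ℝ) (h : A12 φ α a₀ c₁ c₂)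
    (δ γ lam : ℝ) (hδ : 0 < δ) (hγ0 : 0 < γ) (hγ : γ < δ / 2) (hlam : 0 < lam)
    (ρ : ℝ → ℝ) (hsm : ContDiff ℝ (⊤ : ℕ∞) ρ) (hper : ∀ x, ρ (x + 1) = ρ x)
    (hobeys : ∀ a b : ℝ, a ≠ b → |ρ a - ρ b| ≤ moc α δ γ lam |a - b|)
    (x y ξ : ℝ) (hxy : x ≠ y) (hξ : ξ = |x - y|) (hξa : ξ ≤ a₀ / 2)
    (hscen : ρ x - ρ y = moc α δ γ lam ξ) :
    (ξ ≤ lam →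
      limUnder (nhdsWithin (0:ℝ) (Set.Ioi 0))
          (fun ε => ∫ z in {z : ℝ | ε ≤ |z| ∧ |z| ≤ a₀},
            φ z * (moc α δ γ lam ξ - ρ (x + z) + ρ (y + z)))
        ≥ α / (32 * c₁) * δ * lam ^ (-(1:ℝ) - α/2) * ξ ^ (1 - α/2)) ∧
    (lam < ξ →
      limUnder (nhdsWithin (0:ℝ) (Set.Ioi 0))
          (fun ε => ∫ z in {z : ℝ | ε ≤ |z| ∧ |z| ≤ a₀},
            φ z * (moc α δ γ lam ξ - ρ (x + z) + ρ (y + z)))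
        ≥ (2 ^ α - 1) / (2 * α * c₁) * moc α δ γ lam ξ * ξ ^ (-α)) := by
  have hξ0 : 0 < ξ := hξ ▸ abs_pos.2 (sub_ne_zero.2 hxy)
  have hρ : ContDiff ℝ 2 ρ := contDiff_infty.1 hsm 2
  have hob : ∀ a b, ρ a - ρ b ≤ moc α δ γ lam |a - b| := by
    intro a b
    rcases eq_or_ne a b with rfl | hab
    · simp [moc_zero h.αpos hlam]
    · exact (le_abs_self _).trans (hobeys a b hab)
  have hw : ∀ z, ρ (x + z) - ρ (y + z) ≤ moc α δ γ lam ξ := by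
    intro z
    have h1 := hob (x + z) (y + z)
    rwa [add_sub_add_right_eq_sub, ← hξ] at h1
  have hG := symmDefect_nonneg hw
  have hint := h.intervalIntegrable_mul (contDiff_symmDefect hρ x y (moc α δ γ lam ξ))
    (symmDefect_zero hscen) hG
  rw [h.limUnder_eq_integral hρ hscen hw]
  rcases lt_or_gt_of_ne hxy with hlt | hlt
  · have hξ' : -x - -y = ξ := by rw [hξ, abs_of_neg (by linarith)]; ring
    have hob' : ∀ a b, ρ (-a) - ρ (-b) ≤ moc α δ γ lam |a - b| := by
      intro a b
      have h1 := hob (-a) (-b)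
      rwa [neg_sub_neg, abs_sub_comm] at h1
    simp only [← symmDefect_comp_neg ρ x y] at hint hG ⊢
    exact ⟨fun hl => integral_symmDefect_ge_of_le h hδ hγ0 hγ hlam hob' hξ' hξ0 hξa hl hint hG,
      fun hl => integral_symmDefect_ge_of_lt h (hρ.continuous.comp continuous_neg) hδ hγ0 hγ
        hlam hob' hξ' hξa hl hint hG⟩
  · have hξ' : x - y = ξ := by rw [hξ, abs_of_pos (by linarith)]
    exact ⟨fun hl => integral_symmDefect_ge_of_le h hδ hγ0 hγ hlam hob hξ' hξ0 hξa hl hint hG,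
      fun hl => integral_symmDefect_ge_of_lt h hρ.continuous hδ hγ0 hγ hlam hob hξ' hξa hl
        hint hG⟩
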